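/- Fix n ≥ 1 and k ≥ 1 with k ≤ 1+n, and let ω be a k-form on V = ℝ^{1+n}. The energy tensor T of ω satisfies the dominant energy condition: for every pair of observers U₁, U₂ (vectors with η(Uⱼ,Uⱼ) = 1 and η(Uⱼ, e₀) > 0), one has T(U₁, U₂) ≥ 0. -/

import Mathlib

namespace Paper

noncomputable section

/-- The vector space `V = ℝ^{1+n}`. -/
abbrev V (n : ℕ) := Fin (n + 1) → ℝ

/-- The standard basis vectors `e₀, …, e_n`. -/
def eb (n : ℕ) (i : Fin (n + 1)) : V n := Pi.single i 1

/-- The signs `ε₀ = 1`, `ε_i = -1` for `i ≠ 0`. -/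
def eps (n : ℕ) (i : Fin (n + 1)) : ℝ := if i = 0 then 1 else -1

/-- The Minkowski bilinear form `η(x,y) = x₀y₀ − Σᵢ xᵢyᵢ`. -/
def mink (n : ℕ) (x y : V n) : ℝ := ∑ i, eps n i * x i * y i

/-- An observer: a unitary timelike vector oriented to the future. -/
def IsObserver (n : ℕ) (U : V n) : Prop := mink n U U = 1 ∧ 0 < mink n U (eb n 0)

open Classical in
/-- The induced scalar product of two (raw) `k`-forms:
`⟨ω, ω̄⟩ = Σ_{i₁ < ⋯ < i_k} ε_{i₁}⋯ε_{i_k} ω(e_{i₁},…,e_{i_k}) ω̄(e_{i₁},…,e_{i_k})`. -/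
def finner (n k : ℕ) (ω ω' : (Fin k → V n) → ℝ) : ℝ :=
  ∑ v ∈ Finset.univ.filter (fun v : Fin k → Fin (n + 1) => StrictMono v),
    (∏ j, eps n (v j)) * ω (fun j => eb n (v j)) * ω' (fun j => eb n (v j))

/-- Interior product `i_D ω = ω(D, −, …, −)` of a vector with a (raw) `k`-form. -/
def inter (n k : ℕ) (D : V n) (ω : (Fin k → V n) → ℝ) : (Fin (k - 1) → V n) → ℝ :=
  fun v => ω (fun j => if h : (j : ℕ) = 0 then D
    else v ⟨(j : ℕ) - 1, by have := j.isLt; omega⟩)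

/-- The metrically equivalent `1`-form `U* = η(U, −)`. -/
def ustar (n : ℕ) (U : V n) : V n → ℝ := fun w => mink n U w

/-- Wedge product of a `1`-form with a (raw) `k`-form:
`(α ∧ ω)(v₀,…,v_k) = Σ_j (−1)^j α(v_j) ω(v₀,…,v̂_j,…,v_k)`. -/
def wedge1 (n k : ℕ) (α : V n → ℝ) (ω : (Fin k → V n) → ℝ) : (Fin (k + 1) → V n) → ℝ :=
  fun v => ∑ j : Fin (k + 1), (-1 : ℝ) ^ (j : ℕ) * α (v j) * ω (v ∘ j.succAbove)

/-- The electric part `E_U = U* ∧ i_U ω` of a `k`-form with respect to an observer `U`. -/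
def EU (n k : ℕ) (U : V n) (ω : (Fin k → V n) → ℝ) : (Fin (k - 1 + 1) → V n) → ℝ :=
  wedge1 n (k - 1) (ustar n U) (inter n k U ω)

/-- The magnetic part `B_U = i_U (U* ∧ ω)` of a `k`-form with respect to an observer `U`. -/
def BU (n k : ℕ) (U : V n) (ω : (Fin k → V n) → ℝ) : (Fin k → V n) → ℝ :=
  inter n (k + 1) U (wedge1 n k (ustar n U) ω)

/-- Reindexing a raw form along an equality of degrees. -/
def reind (n : ℕ) {m m' : ℕ} (h : m = m') (ω : (Fin m → V n) → ℝ) : (Fin m' → V n) → ℝ :=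
  fun v => ω (fun j => v (Fin.cast h j))

/-- The energy tensor of a `k`-form:
`(−1)^{k−1} T(D₁,D₂) = ⟨i_{D₁}ω, i_{D₂}ω⟩ − (1/2)⟨ω,ω⟩ η(D₁,D₂)`. -/
def energyT (n k : ℕ) (ω : (Fin k → V n) → ℝ) (D₁ D₂ : V n) : ℝ :=
  (-1 : ℝ) ^ (k - 1) * (finner n (k - 1) (inter n k D₁ ω) (inter n k D₂ ω)
    - (1 / 2) * finner n k ω ω * mink n D₁ D₂)

/-- The volume form `dX`, with `dX(e₀,…,e_n) = 1`. -/
def dX (n : ℕ) (u : Fin (n + 1) → V n) : ℝ := Matrix.det (Matrix.of fun i j => u i j)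

/-- The Hodge star of a (raw) `k`-form:
`(*ω)(v₁,…,v_{1+n−k}) = (1/k!) Σ_{i₁,…,i_k} ε_{i₁}⋯ε_{i_k} ω(e_{i₁},…,e_{i_k})
  dX(e_{i₁},…,e_{i_k},v₁,…,v_{1+n−k})`. -/
def hodge (n k : ℕ) (ω : (Fin k → V n) → ℝ) : (Fin (n + 1 - k) → V n) → ℝ :=
  fun v => (1 / (k.factorial : ℝ)) * ∑ i : Fin k → Fin (n + 1),
    (∏ j, eps n (i j)) * ω (fun j => eb n (i j)) *
      dX n (fun l => if h : (l : ℕ) < k then eb n (i ⟨(l : ℕ), h⟩)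
        else v ⟨(l : ℕ) - k, by have := l.isLt; omega⟩)

/-- The bilinear form associated to a matrix `g`. -/
def gbil (n : ℕ) (g : Matrix (Fin (n + 1)) (Fin (n + 1)) ℝ) (x y : V n) : ℝ :=
  ∑ a, ∑ b, g a b * x a * y b

/-- The scalar product of two (raw) `k`-forms with respect to a metric `g` (indices raised
with the inverse matrix `g⁻¹`):
`⟨ω,ω̄⟩_g = (1/k!) Σ g^{i₁j₁}⋯g^{i_kj_k} ω_{i₁…i_k} ω̄_{j₁…j_k}`. -/
def ginner (n : ℕ) (g : Matrix (Fin (n + 1)) (Fin (n + 1)) ℝ) (k : ℕ)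
    (ω ω' : (Fin k → V n) → ℝ) : ℝ :=
  (1 / (k.factorial : ℝ)) * ∑ v : Fin k → Fin (n + 1), ∑ w : Fin k → Fin (n + 1),
    (∏ j, g⁻¹ (v j) (w j)) * ω (fun j => eb n (v j)) * ω' (fun j => eb n (w j))

/-- The energy tensor of a `k`-form with respect to a metric `g`:
`T(g,ω)(D₁,D₂) = (−1)^{k−1}( ⟨i_{D₁}ω, i_{D₂}ω⟩_g − (1/2)⟨ω,ω⟩_g g(D₁,D₂) )`. -/
def energyTg (n : ℕ) (g : Matrix (Fin (n + 1)) (Fin (n + 1)) ℝ) (k : ℕ)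
    (ω : (Fin k → V n) → ℝ) (D₁ D₂ : V n) : ℝ :=
  (-1 : ℝ) ^ (k - 1) * (ginner n g (k - 1) (inter n k D₁ ω) (inter n k D₂ ω)
    - (1 / 2) * ginner n g k ω ω * gbil n g D₁ D₂)

end

end Paper
namespace Paper

open Finset

lemma eps_mul_self (n : ℕ) (i : Fin (n + 1)) : eps n i * eps n i = 1 := by
  unfold eps; split_ifs <;> norm_num

lemma mink_comm (n : ℕ) (x y : V n) : mink n x y = mink n y x :=
  sum_congr rfl fun i _ => by ring

lemma mink_add_left (n : ℕ) (x y z : V n) : mink n (x + y) z = mink n x z + mink n y z := by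
  simp only [mink, ← sum_add_distrib, Pi.add_apply]
  exact sum_congr rfl fun i _ => by ring

lemma mink_smul_left (n : ℕ) (a : ℝ) (x z : V n) : mink n (a • x) z = a * mink n x z := by
  simp only [mink, mul_sum, Pi.smul_apply, smul_eq_mul]
  exact sum_congr rfl fun i _ => by ring

lemma mink_neg_left (n : ℕ) (x z : V n) : mink n (-x) z = -mink n x z := by
  simpa using mink_smul_left n (-1) x z

lemma mink_sub_left (n : ℕ) (x y z : V n) : mink n (x - y) z = mink n x z - mink n y z := by
  rw [sub_eq_add_neg, mink_add_left, mink_neg_left, sub_eq_add_neg]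

lemma mink_add_right (n : ℕ) (x y z : V n) : mink n z (x + y) = mink n z x + mink n z y := by
  simp only [mink_comm n z, mink_add_left]

lemma mink_smul_right (n : ℕ) (a : ℝ) (x z : V n) : mink n z (a • x) = a * mink n z x := by
  simp only [mink_comm n z, mink_smul_left]

lemma mink_neg_right (n : ℕ) (x z : V n) : mink n z (-x) = -mink n z x := by
  simp only [mink_comm n z, mink_neg_left]

lemma mink_sub_right (n : ℕ) (x y z : V n) : mink n z (x - y) = mink n z x - mink n z y := by
  simp only [mink_comm n z, mink_sub_left]

lemma mink_eb_right (n : ℕ) (x : V n) (i : Fin (n + 1)) : mink n x (eb n i) = eps n i * x i := by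
  simp [mink, eb, Pi.single_apply]

lemma mink_eb_left (n : ℕ) (x : V n) (i : Fin (n + 1)) : mink n (eb n i) x = eps n i * x i := by
  rw [mink_comm, mink_eb_right]

lemma mink_eq_sub (n : ℕ) (x y : V n) :
    mink n x y = x 0 * y 0 - ∑ i : Fin n, x i.succ * y i.succ := by
  simp [mink, Fin.sum_univ_succ, eps, sub_eq_add_neg, ← sum_neg_distrib]

/-- The Lorentzian reflection along `w`; it is the identity when `w` is null. -/
noncomputable def reflect (n : ℕ) (w : V n) : V n →ₗ[ℝ] V n where
  toFun x := x - (2 / mink n w w * mink n x w) • w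
  map_add' x y := by
    rw [mink_add_left]
    module
  map_smul' a x := by
    rw [mink_smul_left, RingHom.id_apply]
    module

lemma reflect_apply (n : ℕ) (w x : V n) :
    reflect n w x = x - (2 / mink n w w * mink n x w) • w := rfl

lemma two_div_sq_mul (a : ℝ) : (2 / a) ^ 2 * a = 2 * (2 / a) := by
  rcases eq_or_ne a 0 with rfl | h
  · simp
  · field_simp

lemma mink_reflect_reflect (n : ℕ) (w x y : V n) :
    mink n (reflect n w x) (reflect n w y) = mink n x y := by
  have h := two_div_sq_mul (mink n w w)
  simp only [reflect_apply, mink_sub_left, mink_sub_right, mink_smul_left, mink_smul_right,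
    mink_comm n w y]
  linear_combination mink n x w * mink n y w * h

lemma reflect_reflect (n : ℕ) (w x : V n) : reflect n w (reflect n w x) = x := by
  have h := two_div_sq_mul (mink n w w)
  ext i
  simp only [reflect_apply, mink_sub_left, mink_smul_left, Pi.sub_apply, Pi.smul_apply,
    smul_eq_mul]
  linear_combination mink n x w * w i * h

lemma sum_smul_eb (n : ℕ) (φ : V n →ₗ[ℝ] ℝ) (w : V n) : ∑ i, w i * φ (eb n i) = φ w := by
  conv_rhs => rw [← univ_sum_single w]
  rw [map_sum]
  refine sum_congr rfl fun i _ => ?_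
  rw [← smul_eq_mul, ← map_smul]
  simp [eb, ← Pi.single_smul]

/-- The contravariant metric is invariant under a reflection. -/
lemma sum_eps_reflect (n : ℕ) (w : V n) (φ ψ : V n →ₗ[ℝ] ℝ) :
    ∑ i, eps n i * (φ (reflect n w (eb n i)) * ψ (reflect n w (eb n i)))
      = ∑ i, eps n i * (φ (eb n i) * ψ (eb n i)) := by
  have h := two_div_sq_mul (mink n w w)
  set c := 2 / mink n w w with hc
  have key : ∀ i, eps n i * (φ (reflect n w (eb n i)) * ψ (reflect n w (eb n i)))
      = eps n i * (φ (eb n i) * ψ (eb n i)) - c * ψ w * (w i * φ (eb n i))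
        - c * φ w * (w i * ψ (eb n i)) + c ^ 2 * φ w * ψ w * (eps n i * w i * w i) := by
    intro i
    simp only [reflect_apply, map_sub, map_smul, smul_eq_mul, mink_eb_left, ← hc]
    linear_combination (-(c * ψ w * (w i * φ (eb n i))) - c * φ w * (w i * ψ (eb n i))
      + c ^ 2 * φ w * ψ w * (eps n i * w i * w i)) * eps_mul_self n i
  simp only [key, sum_add_distrib, sum_sub_distrib, ← mul_sum, sum_smul_eb]
  change _ + c ^ 2 * φ w * ψ w * mink n w w = _
  linear_combination φ w * ψ w * h

/-- A multilinear map as a linear function of its first argument. -/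
def applyTail {n k : ℕ} (f : MultilinearMap ℝ (fun _ : Fin (k + 1) => V n) ℝ) (u : Fin k → V n) :
    V n →ₗ[ℝ] ℝ where
  toFun x := f.curryLeft x u
  map_add' x y := by rw [map_add]; rfl
  map_smul' a x := by rw [map_smul]; rfl

lemma applyTail_apply {n k : ℕ} (f : MultilinearMap ℝ (fun _ : Fin (k + 1) => V n) ℝ)
    (u : Fin k → V n) (x : V n) : applyTail f u x = f.curryLeft x u := rfl

lemma sum_prod_eps_reflect (n : ℕ) (w : V n) (k : ℕ)
    (f g : MultilinearMap ℝ (fun _ : Fin k => V n) ℝ) :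
    ∑ v : Fin k → Fin (n + 1), (∏ j, eps n (v j)) *
        (f (fun j => reflect n w (eb n (v j))) * g (fun j => reflect n w (eb n (v j))))
      = ∑ v : Fin k → Fin (n + 1), (∏ j, eps n (v j)) *
        (f (fun j => eb n (v j)) * g (fun j => eb n (v j))) := by
  induction k with
  | zero =>
    refine sum_congr rfl fun v _ => ?_
    congr 3 <;> exact Subsingleton.elim _ _
  | succ k ih =>
    have split : ∀ F : V n → V n,
        ∑ v : Fin (k + 1) → Fin (n + 1), (∏ j, eps n (v j)) *
          (f (fun j => F (eb n (v j))) * g (fun j => F (eb n (v j))))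
        = ∑ i, eps n i * ∑ v : Fin k → Fin (n + 1), (∏ j, eps n (v j)) *
          (f.curryLeft (F (eb n i)) (fun j => F (eb n (v j)))
            * g.curryLeft (F (eb n i)) (fun j => F (eb n (v j)))) := by
      intro F
      rw [← (Fin.consEquiv fun _ => Fin (n + 1)).sum_comp, Fintype.sum_prod_type]
      refine sum_congr rfl fun i _ => ?_
      rw [mul_sum]
      refine sum_congr rfl fun v _ => ?_
      have : (fun j => F (eb n ((Fin.cons i v : Fin (k + 1) → Fin (n + 1)) j)))
          = (Fin.cons (F (eb n i)) (fun j => F (eb n (v j))) : Fin (k + 1) → V n) := by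
        ext j : 1
        refine Fin.cases ?_ (fun j => ?_) j <;> simp
      simp only [Fin.consEquiv_apply, this, Fin.prod_univ_succ, Fin.cons_zero, Fin.cons_succ,
        MultilinearMap.curryLeft_apply]
      ring
    have h1 := split (reflect n w)
    have h2 := split id
    simp only [id] at h2
    rw [h1, h2]
    simp only [ih, mul_sum]
    rw [sum_comm, sum_comm (γ := Fin (n + 1))]
    refine sum_congr rfl fun v _ => ?_
    have key := sum_eps_reflect n w (applyTail f fun j => eb n (v j))
      (applyTail g fun j => eb n (v j))
    simpa only [mul_sum, mul_left_comm, applyTail_apply] using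
      congrArg ((∏ j, eps n (v j)) * ·) key

lemma interior_eq_curryLeft (n m : ℕ) (ω : AlternatingMap ℝ (V n) ℝ (Fin (m + 1))) (D : V n) :
    inter n (m + 1) D ω = ω.curryLeft D := by
  ext v
  change ω _ = ω _
  congr 1
  ext j : 1
  refine Fin.cases ?_ (fun j => ?_) j <;> simp

/-- A symmetric function vanishing on non-injective tuples can be summed over increasing ones. -/
lemma sum_eq_factorial_mul_sum_strictMono {k N : ℕ} (f : (Fin k → Fin N) → ℝ)
    (hperm : ∀ v (σ : Equiv.Perm (Fin k)), f (v ∘ σ) = f v)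
    (hinj : ∀ v, ¬ Function.Injective v → f v = 0)
    [DecidablePred fun v : Fin k → Fin N => StrictMono v] :
    ∑ v, f v = (k.factorial : ℝ) * ∑ v with StrictMono v, f v := by
  classical
  have h1 : ∑ v, f v = ∑ v with Function.Injective v, f v :=
    (sum_filter_of_ne fun v _ h => by_contra fun hv => h (hinj v hv)).symm
  have h2 : ∑ p ∈ (univ : Finset (Equiv.Perm (Fin k))) ×ˢ
      (univ.filter fun v : Fin k → Fin N => StrictMono v), f p.2
      = ∑ v with Function.Injective v, f v := by
    refine sum_nbij' (fun p => p.2 ∘ p.1) (fun v => ((Tuple.sort v)⁻¹, v ∘ Tuple.sort v))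
      ?_ ?_ ?_ ?_ ?_
    · rintro ⟨σ, v⟩ h
      simp only [mem_product, mem_filter, mem_univ, true_and] at h ⊢
      exact h.injective.comp σ.injective
    · intro v h
      simp only [mem_product, mem_filter, mem_univ, true_and] at h ⊢
      exact (Tuple.monotone_sort v).strictMono_of_injective (h.comp (Tuple.sort v).injective)
    · rintro ⟨σ, v⟩ h
      simp only [mem_product, mem_filter, mem_univ, true_and] at h
      have hs : (v ∘ σ) ∘ Tuple.sort (v ∘ σ) = v := by
        rw [Tuple.comp_perm_comp_sort_eq_comp_sort, Tuple.sort_eq_refl_iff_monotone.2 h.monotone]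
        rfl
      refine Prod.ext ?_ hs
      have : ∀ j, σ (Tuple.sort (v ∘ σ) j) = j := fun j => h.injective (congrFun hs j)
      exact (eq_inv_of_mul_eq_one_left (Equiv.ext this)).symm
    · intro v _
      ext j
      simp
    · rintro ⟨σ, v⟩ _
      exact (hperm v σ).symm
  rw [h1, ← h2, sum_product]
  simp [Fintype.card_perm]

lemma factorial_mul_finner (n k : ℕ) (ω ω' : AlternatingMap ℝ (V n) ℝ (Fin k)) :
    (k.factorial : ℝ) * finner n k ω ω' = ∑ v : Fin k → Fin (n + 1), (∏ j, eps n (v j)) *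
        (ω (fun j => eb n (v j)) * ω' (fun j => eb n (v j))) := by
  classical
  rw [sum_eq_factorial_mul_sum_strictMono]
  · simp only [finner, mul_assoc]
  · intro v σ
    have h : ∀ α : AlternatingMap ℝ (V n) ℝ (Fin k),
        α (fun j => eb n ((v ∘ σ) j)) = Equiv.Perm.sign σ • α (fun j => eb n (v j)) :=
      fun α => α.map_perm (fun j => eb n (v j)) σ
    have hs : ∏ j, eps n ((v ∘ σ) j) = ∏ j, eps n (v j) :=
      Equiv.prod_comp σ fun j => eps n (v j)
    rw [h, h, hs]
    rcases Int.units_eq_one_or (Equiv.Perm.sign σ) with hσ | hσ <;> simp [hσ]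
  · intro v hv
    rw [ω.map_eq_zero_of_not_injective _ fun h => hv fun a b hab => h (by simp [hab])]
    simp

lemma finner_reflect (n k : ℕ) (w : V n) (ω ω' : AlternatingMap ℝ (V n) ℝ (Fin k)) :
    finner n k (ω.compLinearMap (reflect n w)) (ω'.compLinearMap (reflect n w))
      = finner n k ω ω' := by
  have hk : (k.factorial : ℝ) ≠ 0 := by positivity
  apply mul_left_cancel₀ hk
  rw [factorial_mul_finner, factorial_mul_finner]
  exact sum_prod_eps_reflect n w k ω.toMultilinearMap ω'.toMultilinearMap

lemma energyT_reflect (n m : ℕ) (w : V n) (ω : AlternatingMap ℝ (V n) ℝ (Fin (m + 1)))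
    (x y : V n) :
    energyT n (m + 1) (ω.compLinearMap (reflect n w)) x y
      = energyT n (m + 1) ω (reflect n w x) (reflect n w y) := by
  have h : ∀ D, (ω.compLinearMap (reflect n w)).curryLeft D
      = (ω.curryLeft (reflect n w D)).compLinearMap (reflect n w) := fun D =>
    AlternatingMap.curryLeft_compLinearMap _ _ _
  simp only [energyT, interior_eq_curryLeft, h, finner_reflect, mink_reflect_reflect]

lemma energyT_neg_neg (n m : ℕ) (ω : AlternatingMap ℝ (V n) ℝ (Fin (m + 1))) (x y : V n) :
    energyT n (m + 1) ω (-x) (-y) = energyT n (m + 1) ω x y := by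
  simp [energyT, interior_eq_curryLeft, finner, mink]

/-- Increasing tuples starting with `p` correspond to increasing tuples of entries beyond `p`. -/
lemma sum_strictMono_head_eq {m N : ℕ} (p : Fin N) (f : (Fin (m + 1) → Fin N) → ℝ)
    [DecidablePred fun v : Fin (m + 1) → Fin N => StrictMono v ∧ v 0 = p]
    [DecidablePred fun v : Fin m → Fin N => StrictMono v ∧ ∀ j, p < v j] :
    ∑ v with StrictMono v ∧ v 0 = p, f v
      = ∑ v with StrictMono v ∧ ∀ j, p < v j, f (Fin.cons p v) := by
  symm
  refine sum_nbij' (fun v => Fin.cons p v) Fin.tail ?_ ?_ ?_ ?_ ?_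
  · intro v h
    simp only [mem_filter, mem_univ, true_and] at h ⊢
    refine ⟨?_, rfl⟩
    intro i j
    refine Fin.cases (fun hj => ?_) (fun i => ?_) i
    · obtain ⟨j, rfl⟩ := Fin.exists_succ_eq.2 hj.ne'
      simpa using h.2 j
    · refine Fin.cases (fun hj => by simp at hj) (fun j hj => ?_) j
      simpa using h.1 (Fin.succ_lt_succ_iff.1 hj)
  · intro v h
    simp only [mem_filter, mem_univ, true_and] at h ⊢
    refine ⟨fun i j hij => h.1 (Fin.succ_lt_succ_iff.2 hij), fun j => ?_⟩
    rw [← h.2]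
    exact h.1 (Fin.succ_pos j)
  · intro v _
    simp
  · intro v h
    simp only [mem_filter, mem_univ, true_and] at h
    rw [← h.2, Fin.cons_self_tail]
  · intro v _
    rfl

lemma curryLeft_eb_eq_zero {n m : ℕ} (ω : AlternatingMap ℝ (V n) ℝ (Fin (m + 1)))
    {p : Fin (n + 1)} {v : Fin m → Fin (n + 1)} {j : Fin m} (hj : v j = p) :
    ω.curryLeft (eb n p) (fun j => eb n (v j)) = 0 := by
  rw [AlternatingMap.curryLeft_apply_apply]
  exact ω.map_eq_zero_of_eq _ (i := 0) (j := j.succ) (by simp [hj]) (Fin.succ_ne_zero j).symm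

lemma prod_eps_of_forall_ne {n k : ℕ} {v : Fin k → Fin (n + 1)} (h : ∀ j, v j ≠ 0) :
    ∏ j, eps n (v j) = (-1 : ℝ) ^ k := by
  simp [eps, h]

lemma apply_eb_cons {n m : ℕ} (ω : AlternatingMap ℝ (V n) ℝ (Fin (m + 1)))
    (p : Fin (n + 1)) (v : Fin m → Fin (n + 1)) :
    ω (fun j => eb n ((Fin.cons p v : Fin (m + 1) → Fin (n + 1)) j))
      = ω.curryLeft (eb n p) (fun j => eb n (v j)) := by
  rw [AlternatingMap.curryLeft_apply_apply]
  congr 1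
  ext j : 1
  refine Fin.cases ?_ (fun j => ?_) j <;> simp

lemma neg_one_pow_mul_self (m : ℕ) : (-1 : ℝ) ^ m * (-1) ^ m = 1 := by
  rw [← mul_pow]; simp

open Classical in
/-- Pairing with the electric part only involves purely spatial components. -/
lemma neg_one_pow_mul_finner_curryLeft (n m : ℕ) (ω : AlternatingMap ℝ (V n) ℝ (Fin (m + 1)))
    (D : V n) :
    (-1 : ℝ) ^ m * finner n m (ω.curryLeft (eb n 0)) (ω.curryLeft D)
      = ∑ v : Fin m → Fin (n + 1) with StrictMono v ∧ ∀ j, 0 < v j,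
        ω.curryLeft (eb n 0) (fun j => eb n (v j)) * ω.curryLeft D (fun j => eb n (v j)) := by
  rw [finner, mul_sum, ← filter_filter, sum_filter (fun v : Fin m → Fin (n + 1) => ∀ j, 0 < v j)]
  refine sum_congr rfl fun v _ => ?_
  split_ifs with h
  · rw [prod_eps_of_forall_ne fun j => (h j).ne']
    linear_combination ω.curryLeft (eb n 0) (fun j => eb n (v j)) *
      ω.curryLeft D (fun j => eb n (v j)) * neg_one_pow_mul_self m
  · push Not at h
    obtain ⟨j, hj⟩ := h
    rw [curryLeft_eb_eq_zero ω (nonpos_iff_eq_zero.1 hj)]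
    ring

open Classical in
lemma neg_one_pow_mul_finner_self (n m : ℕ) (ω : AlternatingMap ℝ (V n) ℝ (Fin (m + 1))) :
    (-1 : ℝ) ^ m * finner n (m + 1) ω ω
      = ∑ v : Fin (m + 1) → Fin (n + 1) with StrictMono v ∧ v 0 = 0, ω (fun j => eb n (v j)) ^ 2
        - ∑ v : Fin (m + 1) → Fin (n + 1) with StrictMono v ∧ v 0 ≠ 0,
          ω (fun j => eb n (v j)) ^ 2 := by
  rw [finner, mul_sum, ← filter_filter, ← filter_filter,
    ← sum_filter_add_sum_filter_not _ (fun v : Fin (m + 1) → Fin (n + 1) => v 0 = 0),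
    sub_eq_add_neg, ← sum_neg_distrib]
  congr 1 <;> refine sum_congr rfl fun v hv => ?_ <;>
    simp only [mem_filter, mem_univ, true_and] at hv
  · have h : ∀ j : Fin m, v j.succ ≠ 0 := fun j => by
      have := hv.1 (Fin.succ_pos j)
      rw [hv.2] at this
      exact this.ne'
    rw [Fin.prod_univ_succ, prod_eps_of_forall_ne h, hv.2]
    simp only [eps, if_true]
    linear_combination ω (fun j => eb n (v j)) ^ 2 * neg_one_pow_mul_self m
  · have h : ∀ j, v j ≠ 0 := fun j hj =>
      hv.2 (nonpos_iff_eq_zero.1 (hj ▸ hv.1.monotone (Fin.zero_le j)))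
    rw [prod_eps_of_forall_ne h, pow_succ]
    linear_combination -ω (fun j => eb n (v j)) ^ 2 * neg_one_pow_mul_self m

lemma energyT_eb_zero_nonneg (n m : ℕ) (ω : AlternatingMap ℝ (V (n + 1)) ℝ (Fin (m + 1)))
    {a b : ℝ} (hab : |b| ≤ a) :
    0 ≤ energyT (n + 1) (m + 1) ω (eb (n + 1) 0) (a • eb (n + 1) 0 + b • eb (n + 1) 1) := by
  classical
  set E : (Fin m → Fin (n + 2)) → ℝ :=
    fun v => ω.curryLeft (eb (n + 1) 0) (fun j => eb (n + 1) (v j))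
  set F : (Fin m → Fin (n + 2)) → ℝ :=
    fun v => ω.curryLeft (eb (n + 1) 1) (fun j => eb (n + 1) (v j)) with hF
  set Q : Finset (Fin m → Fin (n + 2)) := univ.filter fun v => StrictMono v ∧ ∀ j, 0 < v j with hQ
  have h1 : (-1 : ℝ) ^ m * finner (n + 1) m (ω.curryLeft (eb (n + 1) 0))
      (ω.curryLeft (a • eb (n + 1) 0 + b • eb (n + 1) 1))
      = ∑ v ∈ Q, E v * (a * E v + b * F v) := by
    rw [neg_one_pow_mul_finner_curryLeft]
    refine sum_congr rfl fun v _ => ?_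
    rw [map_add, map_smul, map_smul]
    rfl
  have h2 := neg_one_pow_mul_finner_self (n + 1) m ω
  rw [sum_strictMono_head_eq] at h2
  simp only [apply_eb_cons] at h2
  have h3 : ∑ v ∈ Q, F v ^ 2 ≤ ∑ v : Fin (m + 1) → Fin (n + 2) with StrictMono v ∧ v 0 ≠ 0,
      ω (fun j => eb (n + 1) (v j)) ^ 2 := by
    calc ∑ v ∈ Q, F v ^ 2
        = ∑ v : Fin m → Fin (n + 2) with StrictMono v ∧ ∀ j, 1 < v j, F v ^ 2 := by
          symm
          refine sum_subset (fun v hv => ?_) fun v hv hv' => ?_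
          · simp only [hQ, mem_filter, mem_univ, true_and] at hv ⊢
            exact ⟨hv.1, fun j => Fin.zero_lt_one.trans (hv.2 j)⟩
          · simp only [hQ, mem_filter, mem_univ, true_and] at hv hv'
            push Not at hv'
            obtain ⟨j, hj⟩ := hv' hv.1
            have : v j = 1 := le_antisymm hj (Fin.one_le_of_ne_zero (hv.2 j).ne')
            simp only [hF, curryLeft_eb_eq_zero ω this]
            ring
      _ = ∑ v : Fin (m + 1) → Fin (n + 2) with StrictMono v ∧ v 0 = 1,
            ω (fun j => eb (n + 1) (v j)) ^ 2 := by
          rw [sum_strictMono_head_eq]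
          simp only [apply_eb_cons, hF]
      _ ≤ _ := by
          refine sum_le_sum_of_subset_of_nonneg (fun v hv => ?_) fun _ _ _ => sq_nonneg _
          simp only [mem_filter, mem_univ, true_and] at hv ⊢
          exact ⟨hv.1, by simp [hv.2]⟩
  have h4 : mink (n + 1) (eb (n + 1) 0) (a • eb (n + 1) 0 + b • eb (n + 1) 1) = a := by
    rw [mink_eb_left]
    simp [eps, eb]
  have h5 : 0 ≤ ∑ v ∈ Q, (a * E v ^ 2 + a * F v ^ 2 + 2 * b * (E v * F v)) := by
    refine sum_nonneg fun v _ => ?_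
    obtain ⟨hl, hr⟩ := abs_le.1 hab
    nlinarith [mul_nonneg (by linarith : 0 ≤ a + b) (sq_nonneg (E v + F v)),
      mul_nonneg (by linarith : 0 ≤ a - b) (sq_nonneg (E v - F v))]
  have h6 : ∑ v ∈ Q, E v * (a * E v + b * F v)
      = a * ∑ v ∈ Q, E v ^ 2 + b * ∑ v ∈ Q, E v * F v := by
    simp only [mul_sum, ← sum_add_distrib]
    exact sum_congr rfl fun v _ => by ring
  simp only [sum_add_distrib, ← mul_sum] at h5
  have ha : 0 ≤ a := (abs_nonneg b).trans hab
  have h7 := mul_le_mul_of_nonneg_left h3 ha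
  rw [energyT, interior_eq_curryLeft, interior_eq_curryLeft, h4]
  change 0 ≤ (-1 : ℝ) ^ m * (finner (n + 1) m _ _ - _)
  rw [mul_sub, h1, h6]
  linear_combination h5 / 2 + h7 / 2 + a / 2 * h2

/-- Every causal vector is, up to a reflection fixing `e₀`, in the plane of `e₀` and `e₁`. -/
lemma energyT_eb_zero_causal_nonneg (n m : ℕ)
    (ω : AlternatingMap ℝ (V (n + 1)) ℝ (Fin (m + 1)))
    (D : V (n + 1)) (h0 : 0 ≤ D 0) (hD : 0 ≤ mink (n + 1) D D) :
    0 ≤ energyT (n + 1) (m + 1) ω (eb (n + 1) 0) D := by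
  set r := √(∑ i : Fin (n + 1), D i.succ * D i.succ) with hr
  have hs : 0 ≤ ∑ i : Fin (n + 1), D i.succ * D i.succ :=
    sum_nonneg fun _ _ => mul_self_nonneg _
  have hr2 : r * r = ∑ i : Fin (n + 1), D i.succ * D i.succ := Real.mul_self_sqrt hs
  rw [mink_eq_sub, ← hr2] at hD
  have hrD : |r| ≤ D 0 := by
    rw [abs_of_nonneg (Real.sqrt_nonneg _)]
    exact abs_le_of_sq_le_sq' (by nlinarith) h0 |>.2
  set x : V (n + 1) := D 0 • eb (n + 1) 0 + r • eb (n + 1) 1 with hx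
  set w : V (n + 1) := D - x with hw
  have hx0 : x 0 = D 0 := by simp [hx, eb]
  have hDD : mink (n + 1) D D = D 0 * D 0 - r * r := by rw [mink_eq_sub, hr2]
  have hDe : mink (n + 1) D (eb (n + 1) 0) = D 0 := by simp [mink_eb_right, eps]
  have hxx : mink (n + 1) x x = D 0 * D 0 - r * r := by
    simp only [hx, mink_add_left, mink_smul_left, mink_eb_left]
    simp [eb, eps]
    ring
  have hww : mink (n + 1) w w = -2 * mink (n + 1) x w := by
    simp only [hw, mink_sub_left, mink_sub_right, hDD, hxx, mink_comm _ D x]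
    ring
  have hw0 : w 0 = 0 := by simp [hw, hx0]
  have hRe : reflect (n + 1) w (eb (n + 1) 0) = eb (n + 1) 0 := by
    simp [reflect_apply, mink_eb_left, hw0]
  have hRx : reflect (n + 1) w x = D := by
    rw [reflect_apply]
    by_cases h : mink (n + 1) w w = 0
    · have hw' : w = 0 := by
        rw [mink_eq_sub, hw0] at h
        have h' : ∑ i : Fin (n + 1), w i.succ * w i.succ = 0 := by linarith
        rw [sum_eq_zero_iff_of_nonneg fun _ _ => mul_self_nonneg _] at h'
        ext i
        refine Fin.cases hw0 (fun i => ?_) i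
        simpa using h' i (mem_univ _)
      rw [hw', smul_zero, sub_zero]
      exact (sub_eq_zero.1 hw').symm
    · have : 2 / mink (n + 1) w w * mink (n + 1) x w = -1 := by
        field_simp
        linarith
      rw [this, hw]
      simp
  rw [← hRx, ← hRe, ← energyT_reflect]
  exact energyT_eb_zero_nonneg n m _ hrD

lemma IsObserver.zero_pos {n : ℕ} {U : V n} (h : IsObserver n U) : 0 < U 0 := by
  simpa [mink_eb_right, eps] using h.2

/-- Reverse Cauchy–Schwarz inequality. -/
lemma IsObserver.mink_nonneg {n : ℕ} {U W : V n} (hU : IsObserver n U) (hW : IsObserver n W) :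
    0 ≤ mink n U W := by
  have h1 := hU.1
  have h2 := hW.1
  rw [mink_eq_sub] at h1 h2 ⊢
  have h := sum_mul_sq_le_sq_mul_sq univ (fun i : Fin n => U i.succ) (fun i => W i.succ)
  simp only [← pow_two] at h1 h2
  have hW0 : 0 ≤ ∑ i : Fin n, W i.succ ^ 2 := sum_nonneg fun _ _ => sq_nonneg _
  rw [sub_nonneg]
  refine (abs_le_of_sq_le_sq' (h.trans ?_) (mul_pos hU.zero_pos hW.zero_pos).le).2
  nlinarith

end Paper

namespace Paper

/-- the energy tensor of a `k`-form satisfies the dominant energy condition. -/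
theorem statement5 (n k : ℕ) (hn : 1 ≤ n) (hk1 : 1 ≤ k) (hk2 : k ≤ n + 1)
    (ω : AlternatingMap ℝ (V n) ℝ (Fin k))
    (U₁ U₂ : V n) (hU₁ : IsObserver n U₁) (hU₂ : IsObserver n U₂) :
    0 ≤ energyT n k ⇑ω U₁ U₂ := by
  obtain ⟨m, rfl⟩ := Nat.exists_eq_add_of_le' hk1
  obtain ⟨l, rfl⟩ := Nat.exists_eq_add_of_le' hn
  set w := U₁ + eb (l + 1) 0 with hw
  have h00 : mink (l + 1) (eb (l + 1) 0) (eb (l + 1) 0) = 1 := by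
    rw [mink_eb_left]
    simp [eps, eb]
  have hR : reflect (l + 1) w (eb (l + 1) 0) = -U₁ := by
    have hpos := hU₁.2
    have hww : mink (l + 1) w w = 2 * mink (l + 1) (eb (l + 1) 0) w := by
      simp only [hw, mink_add_left, mink_add_right, hU₁.1, h00, mink_comm _ (eb (l + 1) 0) U₁]
      ring
    have hne : mink (l + 1) (eb (l + 1) 0) w ≠ 0 := by
      rw [hw, mink_add_right, h00, mink_comm]
      positivity
    have : 2 / mink (l + 1) w w * mink (l + 1) (eb (l + 1) 0) w = 1 := by
      rw [hww]
      field_simp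
    rw [reflect_apply, this, hw]
    simp
  rw [← energyT_neg_neg, ← hR, ← reflect_reflect (l + 1) w (-U₂), ← energyT_reflect]
  refine energyT_eb_zero_causal_nonneg l m _ _ ?_ ?_
  · have h : reflect (l + 1) w (-U₂) 0
        = mink (l + 1) (reflect (l + 1) w (-U₂)) (eb (l + 1) 0) := by
      simp [mink_eb_right, eps]
    rw [h, ← mink_reflect_reflect (l + 1) w, reflect_reflect, hR, mink_neg_left, mink_neg_right,
      neg_neg]
    exact hU₂.mink_nonneg hU₁
  · rw [mink_reflect_reflect, mink_neg_left, mink_neg_right, hU₂.1]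
    norm_num

end Paper
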